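/- arXiv:0907.0273 — 8 statements merged into one kernel-verified Lean document; each statement's English description precedes it below -/
import Mathlib

section
/- Define Φ : Matrix (Fin 2) (Fin 2) ℝ → Matrix ((Fin 2) ⊕ (Fin 2)) ((Fin 2) ⊕ (Fin 2)) ℝ by sending the matrix with first row (a, b) and second row (c, d) to the 4×4 matrix whose rows, in the basis order (inl 0, inl 1, inr 0, inr 1), are (a³, −√3·a²b, −b³, −√3·ab²), (−√3·a²c, 2abc + a²d, √3·b²d, 2abd + b²c), (−c³, √3·c²d, d³, √3·cd²), (−√3·ac², 2acd + bc², √3·bd², 2bcd + ad²). Then for every g ∈ SL(2,ℝ) the matrix Φ(g) lies in Sp(4,ℝ), and Φ(g·h) = Φ(g)·Φ(h) for all g, h ∈ SL(2,ℝ). (This realizes the 4-dimensional irreducible symplectic representation φ_irr of SL(2,ℝ).) -/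
/-- The 4-dimensional irreducible symplectic representation `φ_irr` of `SL(2,ℝ)`,
given on a 2×2 matrix with entries `a b ; c d` by the explicit 4×4 matrix. -/
noncomputable def phiIrr (m : Matrix (Fin 2) (Fin 2) ℝ) :
    Matrix (Fin 2 ⊕ Fin 2) (Fin 2 ⊕ Fin 2) ℝ :=
  let a : ℝ := m 0 0
  let b : ℝ := m 0 1
  let c : ℝ := m 1 0
  let d : ℝ := m 1 1
  Matrix.fromBlocks
    !![a ^ 3, -Real.sqrt 3 * a ^ 2 * b;
       -Real.sqrt 3 * a ^ 2 * c, 2 * a * b * c + a ^ 2 * d]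
    !![-b ^ 3, -Real.sqrt 3 * a * b ^ 2;
       Real.sqrt 3 * b ^ 2 * d, 2 * a * b * d + b ^ 2 * c]
    !![-c ^ 3, Real.sqrt 3 * c ^ 2 * d;
       -Real.sqrt 3 * a * c ^ 2, 2 * a * c * d + b * c ^ 2]
    !![d ^ 3, Real.sqrt 3 * c * d ^ 2;
       Real.sqrt 3 * b * d ^ 2, 2 * b * c * d + a * d ^ 2]

/-- `φ_irr` is multiplicative on all matrices. -/
theorem phiIrr_mul (m n : Matrix (Fin 2) (Fin 2) ℝ) :
    phiIrr (m * n) = phiIrr m * phiIrr n := by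
  have hs : Real.sqrt 3 ^ 2 = 3 := Real.sq_sqrt (by norm_num)
  simp only [phiIrr, Matrix.fromBlocks_multiply]
  generalize Real.sqrt 3 = s at hs ⊢
  congr 1 <;> ext i j <;> fin_cases i <;> fin_cases j <;>
    simp [Matrix.mul_apply, Fin.sum_univ_two] <;> ring_nf <;> simp only [hs]

/-- `φ_irr` scales the symplectic form by the cube of the determinant. -/
theorem phiIrr_mul_J_mul_transpose (m : Matrix (Fin 2) (Fin 2) ℝ) :
    phiIrr m * Matrix.J (Fin 2) ℝ * (phiIrr m).transpose =
      m.det ^ 3 • Matrix.J (Fin 2) ℝ := by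
  have hs : Real.sqrt 3 ^ 2 = 3 := Real.sq_sqrt (by norm_num)
  simp only [phiIrr, Matrix.J, Matrix.fromBlocks_multiply, Matrix.fromBlocks_transpose,
    Matrix.fromBlocks_smul, Matrix.det_fin_two]
  generalize Real.sqrt 3 = s at hs ⊢
  congr 1 <;> ext i j <;> fin_cases i <;> fin_cases j <;>
    simp [Matrix.vecMul, dotProduct, Fin.sum_univ_two] <;> grind

/-- `φ_irr` maps `SL(2,ℝ)` into `Sp(4,ℝ)` and is multiplicative. -/
theorem phiIrr_mem_symplecticGroup_and_map_mul :
    (∀ g : Matrix.SpecialLinearGroup (Fin 2) ℝ,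
      phiIrr (g : Matrix (Fin 2) (Fin 2) ℝ) ∈ Matrix.symplecticGroup (Fin 2) ℝ) ∧
    (∀ g h : Matrix.SpecialLinearGroup (Fin 2) ℝ,
      phiIrr ((g * h : Matrix.SpecialLinearGroup (Fin 2) ℝ) : Matrix (Fin 2) (Fin 2) ℝ) =
        phiIrr (g : Matrix (Fin 2) (Fin 2) ℝ) * phiIrr (h : Matrix (Fin 2) (Fin 2) ℝ)) := by
  refine ⟨fun g => ?_, fun g h => ?_⟩
  · rw [SymplecticGroup.mem_iff, phiIrr_mul_J_mul_transpose, g.det_coe, one_pow, one_smul]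
  · rw [Matrix.SpecialLinearGroup.coe_mul, phiIrr_mul]
end

section
/- Fix n ≥ 1 and let φ_Δ : SL(2,ℝ) → Sp(2n,ℝ) be the diagonal embedding, φ_Δ of the matrix with rows (a,b),(c,d) being fromBlocks (a·1) (b·1) (c·1) (d·1). A matrix M ∈ Sp(2n,ℝ) commutes with φ_Δ(g) for every g ∈ SL(2,ℝ) if and only if there exists an n×n real matrix A with A * Aᵀ = 1 such that M = fromBlocks A 0 0 A. (Thus the centralizer of the image of the diagonal embedding of SL(2,ℝ) in Sp(2n,ℝ) is isomorphic to the orthogonal group O(n).) -/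
open Matrix
/-- The diagonal embedding `φ_Δ : SL(2,ℝ) → Sp(2n,ℝ)`, sending the matrix with rows
`(a,b),(c,d)` to the block matrix `fromBlocks (a•1) (b•1) (c•1) (d•1)`. -/
def phiDelta (n : ℕ) (m : Matrix (Fin 2) (Fin 2) ℝ) :
    Matrix (Fin n ⊕ Fin n) (Fin n ⊕ Fin n) ℝ :=
  Matrix.fromBlocks (m 0 0 • (1 : Matrix (Fin n) (Fin n) ℝ))
    (m 0 1 • (1 : Matrix (Fin n) (Fin n) ℝ))
    (m 1 0 • (1 : Matrix (Fin n) (Fin n) ℝ))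
    (m 1 1 • (1 : Matrix (Fin n) (Fin n) ℝ))

/-- A matrix `M ∈ Sp(2n,ℝ)` commutes with the image of the diagonal embedding of `SL(2,ℝ)`
if and only if `M = fromBlocks A 0 0 A` with `A` orthogonal: the centralizer of the image
of `φ_Δ` in `Sp(2n,ℝ)` is isomorphic to `O(n)`. -/
theorem centralizer_phiDelta (n : ℕ) (hn : 1 ≤ n)
    (M : Matrix (Fin n ⊕ Fin n) (Fin n ⊕ Fin n) ℝ)
    (hM : M ∈ Matrix.symplecticGroup (Fin n) ℝ) :
    (∀ g : Matrix.SpecialLinearGroup (Fin 2) ℝ,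
      M * phiDelta n (g : Matrix (Fin 2) (Fin 2) ℝ) =
        phiDelta n (g : Matrix (Fin 2) (Fin 2) ℝ) * M) ↔
    ∃ A : Matrix (Fin n) (Fin n) ℝ, A * Aᵀ = 1 ∧ M = Matrix.fromBlocks A 0 0 A := by
  constructor
  · intro h
    have hU := h ⟨!![1, 1; 0, 1], by simp [Matrix.det_fin_two]⟩
    have hL := h ⟨!![1, 0; 1, 1], by simp [Matrix.det_fin_two]⟩
    rw [← Matrix.fromBlocks_toBlocks M] at hU hL hM ⊢
    generalize M.toBlocks₁₁ = A at *
    generalize M.toBlocks₁₂ = B at *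
    generalize M.toBlocks₂₁ = C at *
    generalize M.toBlocks₂₂ = D at *
    simp only [phiDelta, Matrix.fromBlocks_multiply, Matrix.fromBlocks_inj] at hU hL
    simp at hU hL
    obtain ⟨rfl, hAD, -⟩ := hU
    obtain rfl : A = D := by simpa [add_comm B D] using hAD
    obtain rfl : B = 0 := by simpa using hL.1
    rw [SymplecticGroup.mem_iff, Matrix.J, Matrix.fromBlocks_transpose,
      Matrix.fromBlocks_multiply, Matrix.fromBlocks_multiply, Matrix.fromBlocks_inj] at hM
    exact ⟨A, by simpa using hM.2.2.1, rfl⟩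
  · rintro ⟨A, -, rfl⟩ g
    simp [phiDelta, Matrix.fromBlocks_multiply]
end

section
/- Fix n ≥ 1 and let Δ ⊆ V be the diagonal subspace {x ∈ V | ∀ i, x (inl i) = x (inr i)}. A matrix M ∈ Sp(2n,ℝ) satisfies M · L₀ˢ ⊆ L₀ˢ, M · L₀ᵘ ⊆ L₀ᵘ and M · Δ ⊆ Δ (where M acts on V by x ↦ M.mulVec x) if and only if there exists an n×n real matrix A with A * Aᵀ = 1 such that M = fromBlocks A 0 0 A. (Thus the stabilizer in Sp(2n,ℝ) of a positive triple of Lagrangians is isomorphic to the orthogonal group O(n).) -/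
open Matrix

/-- A matrix `M ∈ Sp(2n,ℝ)` stabilizes the two standard transverse Lagrangians
`L₀ˢ`, `L₀ᵘ` and the diagonal Lagrangian `Δ = {x | ∀ i, x (inl i) = x (inr i)}` if and
only if `M = fromBlocks A 0 0 A` with `A` orthogonal: the stabilizer of a positive triple
of Lagrangians in `Sp(2n,ℝ)` is isomorphic to `O(n)`. -/
theorem stabilizer_positive_triple (n : ℕ) (hn : 1 ≤ n)
    (M : Matrix (Fin n ⊕ Fin n) (Fin n ⊕ Fin n) ℝ)
    (hM : M ∈ Matrix.symplecticGroup (Fin n) ℝ) :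
    ((∀ x : (Fin n ⊕ Fin n) → ℝ, (∀ i, x (Sum.inr i) = 0) →
        ∀ i, M.mulVec x (Sum.inr i) = 0) ∧
     (∀ x : (Fin n ⊕ Fin n) → ℝ, (∀ i, x (Sum.inl i) = 0) →
        ∀ i, M.mulVec x (Sum.inl i) = 0) ∧
     (∀ x : (Fin n ⊕ Fin n) → ℝ, (∀ i, x (Sum.inl i) = x (Sum.inr i)) →
        ∀ i, M.mulVec x (Sum.inl i) = M.mulVec x (Sum.inr i))) ↔
    ∃ A : Matrix (Fin n) (Fin n) ℝ, A * Aᵀ = 1 ∧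
      M = Matrix.fromBlocks A 0 0 A := by
  constructor
  · rintro ⟨hs, hu, hd⟩
    obtain ⟨A, B, C, D, rfl⟩ : ∃ A B C D, M = Matrix.fromBlocks A B C D :=
      ⟨_, _, _, _, (Matrix.fromBlocks_toBlocks M).symm⟩
    have hC : C = 0 := by
      refine Matrix.ext_of_mulVec_single fun j => funext fun i => ?_
      simpa [Matrix.fromBlocks_mulVec] using
        hs (Sum.elim (Pi.single j 1) 0) (fun _ => rfl) i
    have hB : B = 0 := by
      refine Matrix.ext_of_mulVec_single fun j => funext fun i => ?_
      simpa [Matrix.fromBlocks_mulVec] using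
        hu (Sum.elim 0 (Pi.single j 1)) (fun _ => rfl) i
    subst hB hC
    have hAD : A = D := by
      refine Matrix.ext_of_mulVec_single fun j => funext fun i => ?_
      simpa [Matrix.fromBlocks_mulVec] using
        hd (Sum.elim (Pi.single j 1) (Pi.single j 1)) (fun _ => rfl) i
    subst hAD
    refine ⟨A, ?_, rfl⟩
    rw [SymplecticGroup.mem_iff] at hM
    simpa [Matrix.J, Matrix.fromBlocks_transpose, Matrix.fromBlocks_multiply] using hM
  · rintro ⟨A, -, rfl⟩
    refine ⟨fun x hx i => ?_, fun x hx i => ?_, fun x hx i => ?_⟩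
    · simp [Matrix.fromBlocks_mulVec, show x ∘ Sum.inr = 0 from funext hx]
    · simp [Matrix.fromBlocks_mulVec, show x ∘ Sum.inl = 0 from funext hx]
    · simp [Matrix.fromBlocks_mulVec, show x ∘ Sum.inl = x ∘ Sum.inr from funext hx]
end

section
/- Fix n ≥ 1 and let L ⊆ V be a Lagrangian subspace. Then L ⊓ L₀ˢ = ⊥ if and only if there exists a unique symmetric n×n real matrix M such that L equals the range of the linear map (Fin n → ℝ) → V sending w to the vector whose inl-components are M.mulVec w and whose inr-components are w. (A Lagrangian can be written as uˢ(M)·L₀ᵘ for a unique symmetric M exactly when it is transverse to L₀ˢ.) -/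
open Matrix

/-- The standard symplectic form `ω` on `V = (Fin n ⊕ Fin n) → ℝ`. -/
def symForm (n : ℕ) (x y : (Fin n ⊕ Fin n) → ℝ) : ℝ :=
  ∑ i : Fin n, (x (Sum.inl i) * y (Sum.inr i) - x (Sum.inr i) * y (Sum.inl i))

/-- A subspace `L ⊆ V` is Lagrangian if `ω` vanishes on `L × L` and `L` has dimension `n`. -/
def IsLagrangian (n : ℕ) (L : Submodule ℝ ((Fin n ⊕ Fin n) → ℝ)) : Prop :=
  (∀ x ∈ L, ∀ y ∈ L, symForm n x y = 0) ∧ Module.finrank ℝ L = n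

/-- The standard Lagrangian `L₀ˢ = {x | ∀ i, x (inr i) = 0}`. -/
def Lzs (n : ℕ) : Submodule ℝ ((Fin n ⊕ Fin n) → ℝ) where
  carrier := {x | ∀ i, x (Sum.inr i) = 0}
  add_mem' := by
    intro a b ha hb i
    simp only [Pi.add_apply, ha i, hb i, add_zero]
  zero_mem' := fun i => rfl
  smul_mem' := by
    intro c a ha i
    simp only [Pi.smul_apply, ha i, smul_zero]

/-- The linear map `(Fin n → ℝ) → V` sending `w` to the vector whose `inl`-components are
`M.mulVec w` and whose `inr`-components are `w`; its range is the Lagrangian `uˢ(M)·L₀ᵘ`. -/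
def graphMap (n : ℕ) (M : Matrix (Fin n) (Fin n) ℝ) :
    (Fin n → ℝ) →ₗ[ℝ] ((Fin n ⊕ Fin n) → ℝ) where
  toFun w := Sum.elim (M.mulVec w) w
  map_add' x y := by
    funext i
    cases i with
    | inl i => simp [Matrix.mulVec_add]
    | inr i => simp
  map_smul' c x := by
    funext i
    cases i with
    | inl i => simp [Matrix.mulVec_smul]
    | inr i => simp

theorem symForm_graphMap_single (n : ℕ) (M : Matrix (Fin n) (Fin n) ℝ) (i j : Fin n) :
    symForm n (graphMap n M (Pi.single i 1)) (graphMap n M (Pi.single j 1)) = M j i - M i j := by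
  simp [symForm, graphMap, Finset.sum_sub_distrib, Pi.single_apply]

theorem graphMap_range_injective (n : ℕ) :
    Function.Injective fun M : Matrix (Fin n) (Fin n) ℝ => LinearMap.range (graphMap n M) := by
  intro M N h
  refine Matrix.mulVec_injective (funext fun w => ?_)
  have hw : graphMap n M w ∈ LinearMap.range (graphMap n N) :=
    h.le (LinearMap.mem_range_self (graphMap n M) w)
  obtain ⟨v, hv⟩ := hw
  have hvw : v = w := funext fun i => congrFun hv (Sum.inr i)
  subst hvw
  exact funext fun i => (congrFun hv (Sum.inl i)).symm

theorem range_graphMap_inf_Lzs (n : ℕ) (M : Matrix (Fin n) (Fin n) ℝ) :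
    LinearMap.range (graphMap n M) ⊓ Lzs n = ⊥ := by
  rw [eq_bot_iff]
  rintro _ ⟨⟨w, rfl⟩, hw⟩
  have hw0 : w = 0 := funext fun i => hw i
  simp [hw0]

/-- An `n`-dimensional subspace transverse to `Lzs n` is the graph of some matrix. -/
theorem exists_eq_range_graphMap (n : ℕ) (L : Submodule ℝ ((Fin n ⊕ Fin n) → ℝ))
    (hdim : Module.finrank ℝ L = n) (h : L ⊓ Lzs n = ⊥) :
    ∃ M : Matrix (Fin n) (Fin n) ℝ, L = LinearMap.range (graphMap n M) := by
  let p : L →ₗ[ℝ] (Fin n → ℝ) := LinearMap.funLeft ℝ ℝ Sum.inr ∘ₗ L.subtype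
  have hp : Function.Injective p := by
    rw [← LinearMap.ker_eq_bot, LinearMap.ker_eq_bot']
    intro x hx
    have hmem : (x : (Fin n ⊕ Fin n) → ℝ) ∈ L ⊓ Lzs n := ⟨x.2, fun i => congrFun hx i⟩
    rw [h, Submodule.mem_bot] at hmem
    exact Subtype.ext hmem
  let e : L ≃ₗ[ℝ] (Fin n → ℝ) := LinearEquiv.ofInjectiveOfFinrankEq p hp (by simp [hdim])
  let f : (Fin n → ℝ) →ₗ[ℝ] (Fin n → ℝ) :=
    LinearMap.funLeft ℝ ℝ Sum.inl ∘ₗ L.subtype ∘ₗ e.symm.toLinearMap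
  have hgraph (x : L) : graphMap n (LinearMap.toMatrix' f) (e x) = x := by
    funext i
    cases i with
    | inl i =>
      change (LinearMap.toMatrix' f *ᵥ e x) i = _
      rw [LinearMap.toMatrix'_mulVec]
      simp [f, LinearMap.funLeft_apply]
    | inr i => rfl
  refine ⟨LinearMap.toMatrix' f, le_antisymm (fun x hx => ⟨e ⟨x, hx⟩, hgraph ⟨x, hx⟩⟩) ?_⟩
  rintro _ ⟨w, rfl⟩
  obtain ⟨x, rfl⟩ := e.surjective w
  rw [hgraph]
  exact x.2

/-- A Lagrangian `L` is transverse to `L₀ˢ` if and only if it is the graph of a unique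
symmetric matrix `M`, i.e. `L = uˢ(M) · L₀ᵘ` for a unique symmetric `M`. -/
theorem lagrangian_transverse_iff_graph (n : ℕ) (hn : 1 ≤ n)
    (L : Submodule ℝ ((Fin n ⊕ Fin n) → ℝ)) (hL : IsLagrangian n L) :
    L ⊓ Lzs n = ⊥ ↔
      ∃! M : Matrix (Fin n) (Fin n) ℝ, Mᵀ = M ∧ L = LinearMap.range (graphMap n M) := by
  constructor
  · intro h
    obtain ⟨M, hM⟩ := exists_eq_range_graphMap n L hL.2 h
    refine ⟨M, ⟨?_, hM⟩, fun N hN => graphMap_range_injective n (hN.2.symm.trans hM)⟩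
    ext i j
    have hmem (w : Fin n → ℝ) : graphMap n M w ∈ L := hM ▸ LinearMap.mem_range_self _ w
    have hω := hL.1 _ (hmem (Pi.single i 1)) _ (hmem (Pi.single j 1))
    rw [symForm_graphMap_single] at hω
    exact sub_eq_zero.mp hω
  · rintro ⟨M, ⟨-, rfl⟩, -⟩
    exact range_graphMap_inf_Lzs n M
end

section
/- Fix n ≥ 1. For any two Lagrangian subspaces L₁, L₂ ⊆ V with L₁ ⊓ L₂ = ⊥, there exists M ∈ Sp(2n,ℝ) such that the linear map x ↦ M.mulVec x maps L₀ˢ onto L₁ and L₀ᵘ onto L₂. (The symplectic group acts transitively on pairs of transverse Lagrangians; the set of such pairs is the unique open Sp(2n,ℝ)-orbit 𝒳 = G/H in 𝓛 × 𝓛.) -/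
open Matrix

/-- The standard Lagrangian `L₀ᵘ = {x | ∀ i, x (inl i) = 0}`. -/
def Lzu (n : ℕ) : Submodule ℝ ((Fin n ⊕ Fin n) → ℝ) where
  carrier := {x | ∀ i, x (Sum.inl i) = 0}
  add_mem' := by
    intro a b ha hb i
    simp only [Pi.add_apply, ha i, hb i, add_zero]
  zero_mem' := fun i => rfl
  smul_mem' := by
    intro c a ha i
    simp only [Pi.smul_apply, ha i, smul_zero]

/-- The standard symplectic form as a bilinear form. -/
def symBilin (n : ℕ) : LinearMap.BilinForm ℝ ((Fin n ⊕ Fin n) → ℝ) :=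
  LinearMap.mk₂ ℝ (symForm n)
    (fun x y z => by
      simp only [symForm, Pi.add_apply, ← Finset.sum_add_distrib]
      exact Finset.sum_congr rfl fun i _ => by ring)
    (fun c x y => by
      simp only [symForm, Pi.smul_apply, smul_eq_mul, Finset.mul_sum]
      exact Finset.sum_congr rfl fun i _ => by ring)
    (fun x y z => by
      simp only [symForm, Pi.add_apply, ← Finset.sum_add_distrib]
      exact Finset.sum_congr rfl fun i _ => by ring)
    (fun c x y => by
      simp only [symForm, Pi.smul_apply, smul_eq_mul, Finset.mul_sum]
      exact Finset.sum_congr rfl fun i _ => by ring)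

@[simp]
lemma symBilin_apply (n : ℕ) (x y : (Fin n ⊕ Fin n) → ℝ) : symBilin n x y = symForm n x y := rfl

lemma symForm_swap (n : ℕ) (x y : (Fin n ⊕ Fin n) → ℝ) : symForm n x y = -symForm n y x := by
  simp only [symForm, ← Finset.sum_neg_distrib]
  exact Finset.sum_congr rfl fun i _ => by ring

lemma dotProduct_J_mulVec (n : ℕ) (x y : (Fin n ⊕ Fin n) → ℝ) :
    x ⬝ᵥ (Matrix.J (Fin n) ℝ *ᵥ y) = -symForm n x y := by
  simp only [dotProduct, Fintype.sum_sum_type, Matrix.J, Matrix.fromBlocks_mulVec, symForm,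
    Sum.elim_inl, Sum.elim_inr, ← Finset.sum_neg_distrib, ← Finset.sum_add_distrib]
  exact Finset.sum_congr rfl fun i _ => by
    simp [Matrix.neg_mulVec]
    ring

lemma eq_zero_of_forall_symForm_eq_zero {n : ℕ} {y : (Fin n ⊕ Fin n) → ℝ}
    (hy : ∀ x, symForm n x y = 0) : y = 0 := by
  funext k
  rcases k with i | i
  · simpa [symForm, Pi.single_apply] using hy (Pi.single (Sum.inr i) 1)
  · simpa [symForm, Pi.single_apply] using hy (Pi.single (Sum.inl i) 1)

lemma IsLagrangian.sup_eq_top {n : ℕ} {L₁ L₂ : Submodule ℝ ((Fin n ⊕ Fin n) → ℝ)}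
    (h₁ : IsLagrangian n L₁) (h₂ : IsLagrangian n L₂) (h : L₁ ⊓ L₂ = ⊥) : L₁ ⊔ L₂ = ⊤ := by
  apply Submodule.eq_top_of_finrank_eq
  have := Submodule.finrank_sup_add_finrank_inf_eq L₁ L₂
  rw [h, finrank_bot, h₁.2, h₂.2] at this
  simpa using this

/-- A basis of a Lagrangian has a dual basis, with respect to `ω`, in any transverse Lagrangian. -/
lemma IsLagrangian.exists_dual_basis {n : ℕ} {L₁ L₂ : Submodule ℝ ((Fin n ⊕ Fin n) → ℝ)}
    (h₁ : IsLagrangian n L₁) (h₂ : IsLagrangian n L₂) (h : L₁ ⊓ L₂ = ⊥)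
    (a : Module.Basis (Fin n) ℝ L₁) :
    ∃ b : Module.Basis (Fin n) ℝ L₂,
      ∀ i j, symForm n (a i) (b j) = (1 : Matrix (Fin n) (Fin n) ℝ) i j := by
  let φ : L₂ →ₗ[ℝ] (Fin n → ℝ) := LinearMap.pi fun i => (symBilin n (a i)).comp L₂.subtype
  have hφ : Function.Injective φ := by
    rw [injective_iff_map_eq_zero]
    intro y hy
    have hL₁ : ∀ x : L₁, symForm n x y = 0 := by
      have hzero : (symBilin n).flip y ∘ₗ L₁.subtype = 0 := a.ext fun i => congrFun hy i
      exact fun x => LinearMap.congr_fun hzero x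
    refine Subtype.ext (eq_zero_of_forall_symForm_eq_zero fun x => ?_)
    obtain ⟨u, hu, v, hv, rfl⟩ := Submodule.mem_sup.mp
      ((h₁.sup_eq_top h₂ h).symm ▸ Submodule.mem_top : x ∈ L₁ ⊔ L₂)
    rw [← symBilin_apply, map_add, LinearMap.add_apply, symBilin_apply, symBilin_apply,
      hL₁ ⟨u, hu⟩, h₂.1 v hv y y.2, add_zero]
  let e : L₂ ≃ₗ[ℝ] (Fin n → ℝ) :=
    LinearEquiv.ofInjectiveOfFinrankEq φ hφ (by simp [h₂.2])
  refine ⟨Module.Basis.ofEquivFun e, fun i j => ?_⟩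
  have hij : e (e.symm (Pi.single j 1)) i = (Pi.single j 1 : Fin n → ℝ) i := by
    rw [LinearEquiv.apply_symm_apply]
  rw [Module.Basis.coe_ofEquivFun, Matrix.one_apply, ← Pi.single_apply]
  exact hij

/-- `Sp(2n,ℝ)` acts transitively on pairs of transverse Lagrangians: any pair of
transverse Lagrangians `(L₁, L₂)` is the image of the standard pair `(L₀ˢ, L₀ᵘ)`
under some symplectic matrix. -/
theorem symplectic_transitive_on_transverse_lagrangians (n : ℕ) (hn : 1 ≤ n)
    (L₁ L₂ : Submodule ℝ ((Fin n ⊕ Fin n) → ℝ))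
    (h₁ : IsLagrangian n L₁) (h₂ : IsLagrangian n L₂) (h : L₁ ⊓ L₂ = ⊥) :
    ∃ M ∈ Matrix.symplecticGroup (Fin n) ℝ,
      Submodule.map (Matrix.mulVecLin M) (Lzs n) = L₁ ∧
      Submodule.map (Matrix.mulVecLin M) (Lzu n) = L₂ := by
  let a := Module.finBasisOfFinrankEq ℝ L₁ h₁.2
  obtain ⟨b, hab⟩ := h₁.exists_dual_basis h₂ h a
  let c : Fin n ⊕ Fin n → (Fin n ⊕ Fin n) → ℝ := Sum.elim (fun i => a i) (fun j => b j)
  let M : Matrix (Fin n ⊕ Fin n) (Fin n ⊕ Fin n) ℝ := (Matrix.of c)ᵀ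
  have hM : ∀ x, M *ᵥ x = ∑ i, x (Sum.inl i) • (a i : (Fin n ⊕ Fin n) → ℝ) +
      ∑ j, x (Sum.inr j) • (b j : (Fin n ⊕ Fin n) → ℝ) := fun x => by
    simp [Matrix.mulVec_eq_sum, Fintype.sum_sum_type, M, c]
    rfl
  refine ⟨M, ?_, le_antisymm ?_ fun y hy => ?_, le_antisymm ?_ fun y hy => ?_⟩
  · rw [SymplecticGroup.mem_iff']
    ext k l
    have hkl : (Mᵀ * Matrix.J (Fin n) ℝ * M) k l = -symForm n (c k) (c l) := by
      rw [← dotProduct_J_mulVec, Matrix.mul_assoc]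
      rfl
    rw [hkl]
    rcases k with i | i <;> rcases l with j | j <;> simp only [c, Sum.elim_inl, Sum.elim_inr]
    · simp [h₁.1 _ (a i).2 _ (a j).2, Matrix.J]
    · simp [hab, Matrix.J]
    · rw [symForm_swap, hab, neg_neg, Matrix.J, Matrix.fromBlocks_apply₂₁, Matrix.one_apply,
        Matrix.one_apply]
      simp only [eq_comm]
    · simp [h₂.1 _ (b i).2 _ (b j).2, Matrix.J]
  · rintro _ ⟨x, hx, rfl⟩
    have hx : ∀ i, x (Sum.inr i) = 0 := hx
    rw [Matrix.mulVecLin_apply, hM]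
    simpa [hx] using L₁.sum_mem fun i _ => L₁.smul_mem (x (Sum.inl i)) (a i).2
  · refine ⟨Sum.elim (a.repr ⟨y, hy⟩) 0, fun i => rfl, ?_⟩
    rw [Matrix.mulVecLin_apply, hM]
    have hsum := congrArg L₁.subtype (a.sum_repr ⟨y, hy⟩)
    rw [map_sum] at hsum
    simpa using hsum
  · rintro _ ⟨x, hx, rfl⟩
    have hx : ∀ i, x (Sum.inl i) = 0 := hx
    rw [Matrix.mulVecLin_apply, hM]
    simpa [hx] using L₂.sum_mem fun i _ => L₂.smul_mem (x (Sum.inr i)) (b i).2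
  · refine ⟨Sum.elim 0 (b.repr ⟨y, hy⟩), fun i => rfl, ?_⟩
    rw [Matrix.mulVecLin_apply, hM]
    have hsum := congrArg L₂.subtype (b.sum_repr ⟨y, hy⟩)
    rw [map_sum] at hsum
    simpa using hsum
end

section
/- Fix n ≥ 1 and let S = {A : Matrix (Fin n) (Fin n) ℝ | (A * Aᵀ − 1).PosDef}. Then: (i) every A ∈ S has det A ≠ 0; (ii) the subsets S⁺ = {A ∈ S | det A > 0} and S⁻ = {A ∈ S | det A < 0} are both nonempty; (iii) S⁺ and S⁻ are each path-connected. (Hence S has exactly two connected components, distinguished by the sign of the determinant; this is the key step in the classification of equivariant positive curves.) -/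
open Matrix

section ExpandingMatrices

variable {ι : Type*} [DecidableEq ι]

namespace Matrix

theorem diagonal_mulSingle_eq_one_add_single (i : ι) (d : ℝ) :
    diagonal (Pi.mulSingle i d) = 1 + single i i (d - 1) := by
  ext a b
  by_cases hab : a = b
  · subst hab
    by_cases ha : i = a
    · subst ha; simp
    · simp [ha, Ne.symm ha]
  · have : ¬ (i = a ∧ i = b) := fun h => hab (h.1.symm.trans h.2)
    simp [hab, this]

variable [Fintype ι]

theorem posDef_mul_transpose_sub_one_iff {A : Matrix ι ι ℝ} :
    (A * Aᵀ - 1).PosDef ↔ ∀ x : ι → ℝ, x ≠ 0 → x ⬝ᵥ x < (x ᵥ* A) ⬝ᵥ (x ᵥ* A) := by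
  have hsymm : (A * Aᵀ - 1).IsHermitian := by
    simp [IsHermitian, conjTranspose_eq_transpose_of_trivial]
  have key (x : ι → ℝ) :
      star x ⬝ᵥ ((A * Aᵀ - 1) *ᵥ x) = (x ᵥ* A) ⬝ᵥ (x ᵥ* A) - x ⬝ᵥ x := by
    rw [star_trivial, sub_mulVec, one_mulVec, dotProduct_sub, ← mulVec_mulVec,
      dotProduct_mulVec, mulVec_transpose]
  simp only [posDef_iff_dotProduct_mulVec, hsymm, true_and, key, sub_pos, ne_eq]

theorem det_ne_zero_of_posDef_mul_transpose_sub_one {A : Matrix ι ι ℝ}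
    (hA : (A * Aᵀ - 1).PosDef) : A.det ≠ 0 := by
  have h : (A * Aᵀ).PosDef := by simpa using hA.add_posSemidef PosSemidef.one
  have h_det := h.det_pos
  rw [det_mul, det_transpose] at h_det
  exact left_ne_zero_of_mul h_det.ne'

theorem PosDef.smul_mul_transpose_sub_one {A : Matrix ι ι ℝ} (hA : (A * Aᵀ - 1).PosDef)
    {c : ℝ} (hc : 1 ≤ c) : ((c • A) * (c • A)ᵀ - 1).PosDef := by
  rw [posDef_mul_transpose_sub_one_iff] at hA ⊢
  intro x hx
  have h := hA x hx
  have hpos : 0 ≤ (x ᵥ* A) ⬝ᵥ (x ᵥ* A) := dotProduct_self_star_nonneg (x ᵥ* A)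
  rw [vecMul_smul, smul_dotProduct, dotProduct_smul, smul_eq_mul, smul_eq_mul]
  nlinarith [mul_nonneg (sub_nonneg.2 hc) hpos,
    mul_nonneg (sub_nonneg.2 hc) (mul_nonneg (sub_nonneg.2 hc) hpos)]

/-- A compact family of invertible matrices becomes expanding after a common rescaling. -/
theorem exists_posDef_smul_mul_transpose_sub_one {X : Type*} [TopologicalSpace X]
    [CompactSpace X] {f : X → Matrix ι ι ℝ} (hf : Continuous f) (hdet : ∀ t, (f t).det ≠ 0) :
    ∃ c : ℝ, 1 ≤ c ∧ ∀ t, ((c • f t) * (c • f t)ᵀ - 1).PosDef := by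
  have hpos (t : X) {x : ι → ℝ} (hx : x ≠ 0) : 0 < (x ᵥ* f t) ⬝ᵥ (x ᵥ* f t) := by
    have hne : x ᵥ* f t ≠ 0 := fun h => hx (eq_zero_of_vecMul_eq_zero (hdet t) h)
    exact dotProduct_star_self_pos_iff.2 hne
  have hK : IsCompact (Set.univ ×ˢ Metric.sphere 0 1 : Set (X × (ι → ℝ))) :=
    isCompact_univ.prod (isCompact_sphere _ _)
  have hcont : ContinuousOn
      (fun p : X × (ι → ℝ) => (p.2 ⬝ᵥ p.2) / ((p.2 ᵥ* f p.1) ⬝ᵥ (p.2 ᵥ* f p.1)))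
      (Set.univ ×ˢ Metric.sphere 0 1) := by
    have hv : Continuous fun p : X × (ι → ℝ) => p.2 ᵥ* f p.1 :=
      continuous_snd.matrix_vecMul (hf.comp continuous_fst)
    refine (continuous_snd.dotProduct continuous_snd).continuousOn.div
      (hv.dotProduct hv).continuousOn ?_
    rintro ⟨t, x⟩ ⟨-, hx⟩
    exact (hpos t (ne_zero_of_mem_unit_sphere (⟨x, hx⟩ : Metric.sphere (0 : ι → ℝ) 1))).ne'
  obtain ⟨M, hM⟩ := hK.bddAbove_image hcont
  refine ⟨|M| + 1, by linarith [abs_nonneg M], fun t => ?_⟩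
  rw [posDef_mul_transpose_sub_one_iff]
  intro x hx
  have hx' : 0 < ‖x‖ := norm_pos_iff.2 hx
  have h := hM (Set.mem_image_of_mem _ (show (t, ‖x‖⁻¹ • x) ∈ _ from
    ⟨Set.mem_univ t, by simp [norm_smul, hx'.ne']⟩))
  simp only [smul_vecMul, smul_dotProduct, dotProduct_smul, smul_eq_mul] at h
  rw [mul_div_mul_left _ _ (inv_ne_zero hx'.ne'), mul_div_mul_left _ _ (inv_ne_zero hx'.ne'),
    div_le_iff₀ (hpos t hx)] at h
  rw [vecMul_smul, smul_dotProduct, dotProduct_smul, smul_eq_mul, smul_eq_mul, ← mul_assoc]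
  refine h.trans_lt (mul_lt_mul_of_pos_right ?_ (hpos t hx))
  nlinarith [abs_nonneg M, le_abs_self M]

/-- Rescaling turns a path of invertible matrices between expanding matrices into a path of
expanding matrices. -/
theorem joinedIn_posDef_mul_transpose_sub_one {A B : Matrix ι ι ℝ}
    (hA : (A * Aᵀ - 1).PosDef) (hB : (B * Bᵀ - 1).PosDef)
    (h : JoinedIn {M : Matrix ι ι ℝ | M.det ≠ 0} A B) :
    JoinedIn {M : Matrix ι ι ℝ | (M * Mᵀ - 1).PosDef} A B := by
  obtain ⟨γ, hγ⟩ := h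
  obtain ⟨c, hc, hγc⟩ := exists_posDef_smul_mul_transpose_sub_one γ.continuous hγ
  have scale {M : Matrix ι ι ℝ} (hM : (M * Mᵀ - 1).PosDef) :
      JoinedIn {M : Matrix ι ι ℝ | (M * Mᵀ - 1).PosDef} M (c • M) := by
    refine JoinedIn.ofLine (f := fun t : ℝ => (1 + t * (c - 1)) • M)
      (Continuous.continuousOn (by fun_prop)) (by simp) (by simp) ?_
    rintro _ ⟨t, ht, rfl⟩
    exact hM.smul_mul_transpose_sub_one
      (by nlinarith [mul_nonneg ht.1 (sub_nonneg.2 hc)])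
  exact ((scale hA).trans ⟨γ.map (continuous_const_smul c), hγc⟩).trans (scale hB).symm

end Matrix

variable [Fintype ι]

theorem JoinedIn.mul_det_ne_zero {A B C D : Matrix ι ι ℝ}
    (hAB : JoinedIn {M : Matrix ι ι ℝ | M.det ≠ 0} A B)
    (hCD : JoinedIn {M : Matrix ι ι ℝ | M.det ≠ 0} C D) :
    JoinedIn {M : Matrix ι ι ℝ | M.det ≠ 0} (A * C) (B * D) := by
  refine (hAB.mul hCD).mono ?_
  rintro _ ⟨M, hM, N, hN, rfl⟩
  simp only [Set.mem_ofPred_eq, det_mul]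
  exact mul_ne_zero hM hN

namespace Matrix

theorem joinedIn_transvection_one {i j : ι} (hij : i ≠ j) (c : ℝ) :
    JoinedIn {M : Matrix ι ι ℝ | M.det ≠ 0} (transvection i j c) 1 := by
  refine JoinedIn.symm (JoinedIn.ofLine (f := fun t : ℝ => 1 + t • single i j c)
    (Continuous.continuousOn (by fun_prop)) (by simp) (by simp [transvection]) ?_)
  rintro _ ⟨t, -, rfl⟩
  have h : 1 + t • single i j c = transvection i j (t * c) := by simp [transvection]
  simp only [Set.mem_ofPred_eq, h, det_transvection_of_ne i j hij]
  exact one_ne_zero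

theorem det_diagonal_mulSingle (i : ι) (d : ℝ) :
    (diagonal (Pi.mulSingle i d)).det = d := by
  simp [det_diagonal]

theorem joinedIn_diagonal_mulSingle (i j : ι) {d : ℝ} (hd : d ≠ 0) :
    JoinedIn {M : Matrix ι ι ℝ | M.det ≠ 0}
      (diagonal (Pi.mulSingle i d)) (diagonal (Pi.mulSingle j d)) := by
  have hmem (k : ι) : diagonal (Pi.mulSingle k d) ∈ {M : Matrix ι ι ℝ | M.det ≠ 0} := by
    rwa [Set.mem_ofPred_eq, det_diagonal_mulSingle]
  rcases eq_or_ne i j with rfl | hij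
  · exact JoinedIn.refl (hmem i)
  -- `G` is a signed swap of `i` and `j`
  set G : Matrix ι ι ℝ := transvection i j 1 * transvection j i (-1) * transvection i j 1
    with hG
  have hG_one : JoinedIn {M : Matrix ι ι ℝ | M.det ≠ 0} G 1 := by
    simpa using ((joinedIn_transvection_one hij 1).mul_det_ne_zero
      (joinedIn_transvection_one hij.symm (-1))).mul_det_ne_zero (joinedIn_transvection_one hij 1)
  have hcomm : G * diagonal (Pi.mulSingle i d) = diagonal (Pi.mulSingle j d) * G := by
    simp only [hG, diagonal_mulSingle_eq_one_add_single, transvection, mul_add, add_mul, mul_one,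
      one_mul, single_mul_single_same, ne_eq, hij.symm, not_false_eq_true,
      single_mul_single_of_ne, add_zero]
    ext a b
    simp only [add_apply, single_apply]
    split_ifs <;> ring
  have h₁ := hG_one.mul_det_ne_zero (JoinedIn.refl (hmem i))
  have h₂ := (JoinedIn.refl (hmem j)).mul_det_ne_zero hG_one
  rw [one_mul, hcomm] at h₁
  rw [mul_one] at h₂
  exact h₁.symm.trans h₂

theorem joinedIn_diagonal_mulSingle_det (i : ι) {A : Matrix ι ι ℝ} (hA : A.det ≠ 0) :
    JoinedIn {M : Matrix ι ι ℝ | M.det ≠ 0} A (diagonal (Pi.mulSingle i A.det)) := by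
  have hdiag (v w : ι → ℝ) : diagonal v * diagonal w = diagonal (v * w) :=
    diagonal_mul_diagonal v w
  have hmul {A B : Matrix ι ι ℝ}
      (h₁ : JoinedIn {M : Matrix ι ι ℝ | M.det ≠ 0} A (diagonal (Pi.mulSingle i A.det)))
      (h₂ : JoinedIn {M : Matrix ι ι ℝ | M.det ≠ 0} B (diagonal (Pi.mulSingle i B.det))) :
      JoinedIn {M : Matrix ι ι ℝ | M.det ≠ 0} (A * B)
        (diagonal (Pi.mulSingle i (A * B).det)) := by
    have h := h₁.mul_det_ne_zero h₂
    rwa [hdiag, ← Pi.mulSingle_mul, ← det_mul] at h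
  have hone : JoinedIn {M : Matrix ι ι ℝ | M.det ≠ 0} (1 : Matrix ι ι ℝ)
      (diagonal (Pi.mulSingle i (1 : Matrix ι ι ℝ).det)) := by
    simpa using JoinedIn.refl (F := {M : Matrix ι ι ℝ | M.det ≠ 0}) (x := 1) (by simp)
  refine diagonal_transvection_induction_of_det_ne_zero
    (fun A => JoinedIn {M : Matrix ι ι ℝ | M.det ≠ 0} A (diagonal (Pi.mulSingle i A.det)))
    A hA (fun v hv => ?_) (fun t => ?_) (fun A B _ _ => hmul)
  · rw [det_diagonal, Finset.prod_ne_zero_iff] at hv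
    rw [← Finset.univ_prod_mulSingle v]
    induction (Finset.univ : Finset ι) using Finset.induction_on with
    | empty => simpa using hone
    | insert k s hk ih =>
      rw [Finset.prod_insert hk]
      have h := joinedIn_diagonal_mulSingle k i (hv k (Finset.mem_univ k))
      nth_rw 2 [← det_diagonal_mulSingle k (v k)] at h
      simpa only [hdiag] using hmul h ih
  · simpa [TransvectionStruct.toMatrix, det_transvection_of_ne _ _ t.hij] using
      joinedIn_transvection_one t.hij t.c

theorem joinedIn_det_ne_zero [Nonempty ι] {A B : Matrix ι ι ℝ} (h : 0 < A.det * B.det) :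
    JoinedIn {M : Matrix ι ι ℝ | M.det ≠ 0} A B := by
  obtain ⟨i⟩ := ‹Nonempty ι›
  have hA : A.det ≠ 0 := left_ne_zero_of_mul h.ne'
  have hB : B.det ≠ 0 := right_ne_zero_of_mul h.ne'
  refine ((joinedIn_diagonal_mulSingle_det i hA).trans ?_).trans
    (joinedIn_diagonal_mulSingle_det i hB).symm
  refine JoinedIn.ofLine
    (f := fun t : ℝ => diagonal (Pi.mulSingle i (A.det + t * (B.det - A.det)))) ?_
    (by simp) (by simp) ?_
  · exact (((continuous_mulSingle i).comp (by fun_prop)).matrix_diagonal).continuousOn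
  · rintro _ ⟨t, ⟨ht₀, ht₁⟩, rfl⟩
    rw [Set.mem_ofPred_eq, det_diagonal_mulSingle]
    intro h0
    have hsq : 0 < A.det ^ 2 := by positivity
    have hzero : (1 - t) * A.det ^ 2 + t * (A.det * B.det) = 0 := by
      linear_combination A.det * h0
    rcases ht₀.eq_or_lt with rfl | ht
    · simp at hzero; exact hA hzero
    · nlinarith [mul_pos ht h, mul_nonneg (sub_nonneg.2 ht₁) hsq.le]

end Matrix

theorem Path.det_mul_det_pos {A B : Matrix ι ι ℝ} (γ : Path A B) (hγ : ∀ t, (γ t).det ≠ 0)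
    (t : unitInterval) : 0 < A.det * (γ t).det := by
  by_contra! hneg
  have hcont : Continuous fun t => A.det * (γ t).det :=
    continuous_const.mul γ.continuous.matrix_det
  obtain ⟨u, hu⟩ := mem_range_of_exists_le_of_exists_ge hcont
    ⟨t, hneg⟩ ⟨0, by simpa using mul_self_nonneg A.det⟩
  have hA : A.det ≠ 0 := by simpa using hγ 0
  exact mul_ne_zero hA (hγ u) hu

namespace Matrix

theorem isPathConnected_posDef_mul_transpose_sub_one [Nonempty ι] {s : ℝ} (hs : s ≠ 0) :
    IsPathConnected {A : Matrix ι ι ℝ | (A * Aᵀ - 1).PosDef ∧ 0 < s * A.det} := by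
  refine isPathConnected_iff.2 ⟨?_, ?_⟩
  · obtain ⟨i⟩ := ‹Nonempty ι›
    obtain ⟨c, hc, h⟩ := exists_posDef_smul_mul_transpose_sub_one (X := Unit)
      (f := fun _ => diagonal (Pi.mulSingle i s)) continuous_const
      (fun _ => by rwa [det_diagonal_mulSingle])
    refine ⟨_, h (), ?_⟩
    rw [det_smul, det_diagonal_mulSingle]
    have : 0 < c := by linarith
    have : 0 < s ^ 2 := by positivity
    calc 0 < c ^ Fintype.card ι * s ^ 2 := by positivity
      _ = s * (c ^ Fintype.card ι * s) := by ring
  · rintro A ⟨hA, hA_det⟩ B ⟨hB, hB_det⟩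
    have hAB : 0 < A.det * B.det := by
      refine pos_of_mul_pos_right (a := s ^ 2) ?_ (sq_nonneg s)
      calc 0 < s * A.det * (s * B.det) := mul_pos hA_det hB_det
        _ = s ^ 2 * (A.det * B.det) := by ring
    obtain ⟨γ, hγ⟩ := joinedIn_posDef_mul_transpose_sub_one hA hB (joinedIn_det_ne_zero hAB)
    refine ⟨γ, fun t => ⟨hγ t, ?_⟩⟩
    have hAt := γ.det_mul_det_pos (fun u => det_ne_zero_of_posDef_mul_transpose_sub_one (hγ u)) t
    refine pos_of_mul_pos_right (a := A.det ^ 2) ?_ (sq_nonneg _)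
    calc 0 < s * A.det * (A.det * (γ t).det) := mul_pos hA_det hAt
      _ = A.det ^ 2 * (s * (γ t).det) := by ring

end Matrix

end ExpandingMatrices

/-- Consider the set `S = {A | A·Aᵀ − 1 is positive definite}` of real `n×n` matrices.
Every element of `S` has nonzero determinant; the subsets `S⁺` and `S⁻` of matrices with
positive, resp. negative, determinant are nonempty and each is path-connected.
Hence `S` has exactly two connected components, distinguished by the sign of the
determinant. -/
theorem components_of_expanding_matrices (n : ℕ) (hn : 1 ≤ n) :
    (∀ A : Matrix (Fin n) (Fin n) ℝ, (A * Aᵀ - 1).PosDef → A.det ≠ 0) ∧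
    {A : Matrix (Fin n) (Fin n) ℝ | (A * Aᵀ - 1).PosDef ∧ 0 < A.det}.Nonempty ∧
    {A : Matrix (Fin n) (Fin n) ℝ | (A * Aᵀ - 1).PosDef ∧ A.det < 0}.Nonempty ∧
    IsPathConnected {A : Matrix (Fin n) (Fin n) ℝ | (A * Aᵀ - 1).PosDef ∧ 0 < A.det} ∧
    IsPathConnected {A : Matrix (Fin n) (Fin n) ℝ | (A * Aᵀ - 1).PosDef ∧ A.det < 0} := by
  have : Nonempty (Fin n) := ⟨⟨0, hn⟩⟩
  have hpos := isPathConnected_posDef_mul_transpose_sub_one (ι := Fin n) (one_ne_zero (α := ℝ))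
  have hneg := isPathConnected_posDef_mul_transpose_sub_one (ι := Fin n)
    (neg_ne_zero.2 (one_ne_zero (α := ℝ)))
  simp only [one_mul] at hpos
  simp only [neg_mul, one_mul, neg_pos] at hneg
  exact ⟨fun A => det_ne_zero_of_posDef_mul_transpose_sub_one, hpos.nonempty, hneg.nonempty,
    hpos, hneg⟩
end

section
/- Fix n ≥ 1 and let A be an n×n real matrix. Then (A * Aᵀ − 1).PosDef holds if and only if there exists a continuous function f : ℝ → Matrix (Fin n) (Fin n) ℝ such that f 0 = 1, (f t).IsSymm for every t, f (t+1) = A * (f t) * Aᵀ for every t, and (f t − f s).PosDef whenever s < t. (This identifies the image of the normalized space S₀ of equivariant positive paths of symmetric matrices under the map (A, ξ̃) ↦ A as the set {A ∈ GL(n,ℝ) | A·Aᵀ − 1 positive definite}.) -/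
open Matrix

/-- The piecewise linear function on `ℝ` that agrees with `G` at the integers. -/
noncomputable def intInterpolation {E : Type*} [AddCommGroup E] [Module ℝ E] (G : ℤ → E)
    (t : ℝ) : E :=
  G ⌊t⌋ + Int.fract t • (G (⌊t⌋ + 1) - G ⌊t⌋)

theorem intInterpolation_eq_of_mem_Icc {E : Type*} [AddCommGroup E] [Module ℝ E] (G : ℤ → E)
    {k : ℤ} {t : ℝ} (ht : t ∈ Set.Icc (k : ℝ) (k + 1)) :
    intInterpolation G t = G k + (t - k) • (G (k + 1) - G k) := by
  rcases ht.2.lt_or_eq with h | h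
  · have hk : ⌊t⌋ = k := Int.floor_eq_iff.2 ⟨ht.1, h⟩
    rw [intInterpolation, Int.fract, hk]
  · have hk : t = ((k + 1 : ℤ) : ℝ) := by push_cast; exact h
    subst hk
    simp [intInterpolation]

theorem continuous_intInterpolation {E : Type*} [AddCommGroup E] [Module ℝ E]
    [TopologicalSpace E] [ContinuousAdd E] [ContinuousSMul ℝ E] (G : ℤ → E) :
    Continuous (intInterpolation G) := by
  have hfin : LocallyFinite fun k : ℤ => Set.Icc (k : ℝ) (k + 1) :=
    locallyFinite_Icc_of_tendsto tendsto_intCast_atTop_atTop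
      (Filter.tendsto_atBot_add_const_right _ _ (tendsto_intCast_atBot_iff.2 Filter.tendsto_id))
  refine hfin.continuous (iUnion_Icc_intCast ℝ) (fun _ => isClosed_Icc) fun k => ?_
  refine ContinuousOn.congr (f := fun t : ℝ => G k + (t - k) • (G (k + 1) - G k)) ?_
    fun t ht => intInterpolation_eq_of_mem_Icc G ht
  fun_prop

theorem intInterpolation_add_one {E : Type*} [AddCommGroup E] [Module ℝ E] (G : ℤ → E) (t : ℝ) :
    intInterpolation G (t + 1) = intInterpolation (fun k => G (k + 1)) t := by
  simp [intInterpolation]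

theorem map_intInterpolation {E F : Type*} [AddCommGroup E] [Module ℝ E] [AddCommGroup F]
    [Module ℝ F] (L : E →ₗ[ℝ] F) (G : ℤ → E) (t : ℝ) :
    L (intInterpolation G t) = intInterpolation (fun k => L (G k)) t := by
  simp [intInterpolation]

theorem StrictMono.intInterpolation {G : ℤ → ℝ} (hG : StrictMono G) :
    StrictMono (intInterpolation G) := by
  intro s t hst
  have hs := sub_pos.2 (hG (lt_add_one ⌊s⌋))
  have ht := sub_pos.2 (hG (lt_add_one ⌊t⌋))
  simp only [_root_.intInterpolation, smul_eq_mul]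
  rcases (Int.floor_mono hst.le).lt_or_eq with h | h
  · have h1 : G (⌊s⌋ + 1) ≤ G ⌊t⌋ := hG.monotone h
    nlinarith [Int.fract_lt_one s, mul_nonneg (Int.fract_nonneg t) ht.le]
  · have h1 : Int.fract s < Int.fract t := by
      rw [Int.fract, Int.fract, h]; linarith
    rw [h] at hs ⊢
    gcongr

/-- A real `n×n` matrix `A` satisfies `A·Aᵀ − 1` positive definite if and only if there is
a continuous path `f` of symmetric matrices, normalized by `f 0 = 1`, equivariant in the
sense `f (t+1) = A · f t · Aᵀ`, and strictly increasing for the Loewner order. -/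
theorem expanding_iff_exists_equivariant_positive_path (n : ℕ) (hn : 1 ≤ n)
    (A : Matrix (Fin n) (Fin n) ℝ) :
    (A * Aᵀ - 1).PosDef ↔
      ∃ f : ℝ → Matrix (Fin n) (Fin n) ℝ, Continuous f ∧ f 0 = 1 ∧
        (∀ t, (f t).IsSymm) ∧ (∀ t, f (t + 1) = A * f t * Aᵀ) ∧
        (∀ s t : ℝ, s < t → (f t - f s).PosDef) := by
  constructor
  · intro hA
    have hAu : IsUnit A.det := by
      have h : (A * Aᵀ).PosDef := by simpa using hA.add PosDef.one
      have h2 := (isUnit_iff_isUnit_det _).1 h.isUnit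
      rw [det_mul] at h2
      exact isUnit_of_mul_isUnit_left h2
    let G : ℤ → Matrix (Fin n) (Fin n) ℝ := fun k => A ^ k * (A ^ k)ᵀ
    have hGstep (k : ℤ) : G (k + 1) = A * G k * Aᵀ := by
      simp only [G, add_comm k 1, zpow_one_add hAu, transpose_mul, Matrix.mul_assoc]
    have hGpos (k : ℤ) : (G (k + 1) - G k).PosDef := by
      have hU : IsUnit (A ^ k) := (isUnit_iff_isUnit_det _).2 (hAu.det_zpow k)
      have h := hU.posDef_star_right_conjugate_iff.2 hA
      convert h using 1
      simp only [G, zpow_add_one hAu, transpose_mul, star_eq_conjTranspose,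
        conjTranspose_eq_transpose_of_trivial, Matrix.mul_sub, Matrix.sub_mul, Matrix.mul_assoc,
        Matrix.one_mul]
    have hsymm (t : ℝ) : (intInterpolation G t).IsSymm := by
      have h := map_intInterpolation
        (transposeLinearEquiv (Fin n) (Fin n) ℝ ℝ).toLinearMap G t
      simpa [G, transpose_mul, IsSymm] using h
    refine ⟨intInterpolation G, continuous_intInterpolation G, by simp [intInterpolation, G],
      hsymm, fun t => ?_, fun s t hst => ?_⟩
    · have h := map_intInterpolation
        ((LinearMap.mulRight ℝ Aᵀ).comp (LinearMap.mulLeft ℝ A)) G t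
      simp only [LinearMap.comp_apply, LinearMap.mulRight_apply, LinearMap.mulLeft_apply] at h
      rw [intInterpolation_add_one, h]
      simp only [hGstep]
    · refine PosDef.of_dotProduct_mulVec_pos ?_ fun x hx => ?_
      · rw [IsHermitian, conjTranspose_eq_transpose_of_trivial]
        exact (hsymm t).sub (hsymm s)
      · let L : Matrix (Fin n) (Fin n) ℝ →ₗ[ℝ] ℝ :=
          { toFun := fun M => star x ⬝ᵥ M *ᵥ x
            map_add' := by simp [add_mulVec, dotProduct_add]
            map_smul' := by simp [smul_mulVec, dotProduct_smul] }
        have hmono : StrictMono fun k => L (G k) := by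
          refine strictMono_int_of_lt_succ fun k => ?_
          rw [← sub_pos, ← map_sub]
          exact (hGpos k).dotProduct_mulVec_pos hx
        have h := hmono.intInterpolation hst
        rw [← map_intInterpolation, ← map_intInterpolation, ← sub_pos, ← map_sub] at h
        exact h
  · rintro ⟨f, -, h0, -, hstep, hpos⟩
    have h := hpos 0 1 one_pos
    rwa [← zero_add (1 : ℝ), hstep 0, h0, Matrix.mul_one] at h
end

section
/- Fix n ≥ 0 and an n×n real matrix A. The set of functions f : ℝ → Matrix (Fin n) (Fin n) ℝ such that f is continuous, (f t).IsSymm for every t, f 0 = 1, f (t+1) = A * (f t) * Aᵀ for every t, and (f t − f s).PosDef whenever s < t, is a convex subset of the real vector space of all functions ℝ → Matrix (Fin n) (Fin n) ℝ with pointwise operations. (These are the fibers of the map (A, ξ̃) ↦ A on the normalized space S₀ of equivariant positive paths; their convexity shows they are connected.) -/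
open Matrix

/-- For a fixed matrix `A`, the set of continuous paths of symmetric matrices which are
normalized at `0`, equivariant under `t ↦ t+1` via conjugation by `A`, and strictly
increasing for the Loewner order, is convex in the space of all functions
`ℝ → Matrix (Fin n) (Fin n) ℝ` with pointwise operations. -/
theorem convex_equivariant_positive_paths (n : ℕ) (A : Matrix (Fin n) (Fin n) ℝ) :
    Convex ℝ {f : ℝ → Matrix (Fin n) (Fin n) ℝ |
      Continuous f ∧ (∀ t, (f t).IsSymm) ∧ f 0 = 1 ∧
      (∀ t, f (t + 1) = A * f t * Aᵀ) ∧
      ∀ s t : ℝ, s < t → (f t - f s).PosDef} := by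
  rw [convex_iff_forall_pos]
  rintro f ⟨hfc, hfs, hf0, hfe, hfp⟩ g ⟨hgc, hgs, hg0, hge, hgp⟩ a b ha hb hab
  refine ⟨(hfc.const_smul a).add (hgc.const_smul b),
    fun t => ((hfs t).smul a).add ((hgs t).smul b), ?_, fun t => ?_, fun s t hst => ?_⟩
  · simp only [Pi.add_apply, Pi.smul_apply, hf0, hg0, ← add_smul, hab, one_smul]
  · simp only [Pi.add_apply, Pi.smul_apply, hfe, hge, mul_add, add_mul, mul_smul_comm,
      smul_mul_assoc]
  · have h : (a • f + b • g) t - (a • f + b • g) s = a • (f t - f s) + b • (g t - g s) := by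
      simp only [Pi.add_apply, Pi.smul_apply, smul_sub]
      abel
    rw [h]
    exact ((hfp s t hst).smul ha).add ((hgp s t hst).smul hb)
end
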